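/- arXiv:0903.5503 — 5 statements merged into one kernel-verified Lean document; each statement's English description precedes it below -/
import Mathlib

section
/- Let p ≥ 1 and k be integers. The group with presentation ⟨x, y, a₁, b₁, a₂, b₂ | [x,a₁] = [y,a₁] = [x,a₂] = [y,a₂] = 1, [b₁,b₂] = [a₁,b₂] = [b₁,a₁] = [b₂,a₂] = 1, [x,y] = 1, b₁ = [a₂⁻¹,a₁⁻¹], a₁ = [b₁⁻¹,y⁻¹], b₂ = [b₁,a₂], x⁻¹ = [b₂⁻¹,y⁻¹], a₂ᵖ = [x⁻¹,b₂], y = [x⁻¹,b₁]ᵏ⟩ is isomorphic to the cyclic group ℤ/pℤ, generated by the image of a₂. -/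
/-- Generators of the presentation: `x, y, a₁, b₁, a₂, b₂`. -/
inductive Gen8 : Type
  | x | y | a1 | b1 | a2 | b2
  deriving DecidableEq

namespace Gen8

/-- The commutator `[u, v] = u v u⁻¹ v⁻¹` in the free group. -/
def fgComm (u v : FreeGroup Gen8) : FreeGroup Gen8 := u * v * u⁻¹ * v⁻¹

def X : FreeGroup Gen8 := FreeGroup.of Gen8.x
def Y : FreeGroup Gen8 := FreeGroup.of Gen8.y
def A1 : FreeGroup Gen8 := FreeGroup.of Gen8.a1
def B1 : FreeGroup Gen8 := FreeGroup.of Gen8.b1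
def A2 : FreeGroup Gen8 := FreeGroup.of Gen8.a2
def B2 : FreeGroup Gen8 := FreeGroup.of Gen8.b2

/-- Relators: commutation relations from π₁ of Baldridge–Kirk's symplectic sum, together
with the relations introduced by the six torus surgeries (a relation `u = v` becomes the
relator `u * v⁻¹`). -/
def rels8 (p : ℕ) (k : ℤ) : Set (FreeGroup Gen8) :=
  { fgComm X A1, fgComm Y A1, fgComm X A2, fgComm Y A2,
    fgComm B1 B2, fgComm A1 B2, fgComm B1 A1, fgComm B2 A2,
    fgComm X Y,
    B1 * (fgComm A2⁻¹ A1⁻¹)⁻¹,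
    A1 * (fgComm B1⁻¹ Y⁻¹)⁻¹,
    B2 * (fgComm B1 A2)⁻¹,
    X⁻¹ * (fgComm B2⁻¹ Y⁻¹)⁻¹,
    A2 ^ p * (fgComm X⁻¹ B2)⁻¹,
    Y * ((fgComm X⁻¹ B1) ^ k)⁻¹ }

end Gen8

theorem PresentedGroup.eq_top_of_forall_of_mem {α : Type*}
    {rels : Set (FreeGroup α)} {H : Subgroup (PresentedGroup rels)}
    (h : ∀ a, PresentedGroup.of a ∈ H) : H = ⊤ := by
  rw [eq_top_iff, ← PresentedGroup.closure_range_of rels, Subgroup.closure_le]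
  rintro _ ⟨a, rfl⟩
  exact h a

namespace Gen8

open scoped commutatorElement

/-- The relations of `rels8` kill every generator except `a₂`, whose `p`-th power they kill. -/
theorem trivial_of_relations {G : Type*} [Group G] {x y a₁ b₁ a₂ b₂ : G} {p : ℕ} {k : ℤ}
    (ya₁ : Commute y a₁) (ya₂ : Commute y a₂)
    (hb₁ : b₁ = ⁅a₂⁻¹, a₁⁻¹⁆) (ha₁ : a₁ = ⁅b₁⁻¹, y⁻¹⁆) (hb₂ : b₂ = ⁅b₁, a₂⁆)
    (hx : x⁻¹ = ⁅b₂⁻¹, y⁻¹⁆) (ha₂ : a₂ ^ p = ⁅x⁻¹, b₂⁆) (hy : y = ⁅x⁻¹, b₁⁆ ^ k) :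
    x = 1 ∧ y = 1 ∧ a₁ = 1 ∧ b₁ = 1 ∧ b₂ = 1 ∧ a₂ ^ p = 1 := by
  have yb₁ : Commute y b₁ := by
    rw [hb₁, commutatorElement_def]
    exact (((ya₂.inv_right.mul_right ya₁.inv_right).mul_right ya₂.inv_right.inv_right).mul_right
      ya₁.inv_right.inv_right)
  have a₁_eq : a₁ = 1 := by
    rw [ha₁, commutatorElement_eq_one_iff_commute]
    exact yb₁.symm.inv_inv
  have b₁_eq : b₁ = 1 := by simp [hb₁, a₁_eq]
  have b₂_eq : b₂ = 1 := by simp [hb₂, b₁_eq]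
  have x_eq : x = 1 := by simpa [b₂_eq] using hx
  exact ⟨x_eq, by simp [hy, b₁_eq], a₁_eq, b₁_eq, b₂_eq, by simp [ha₂, b₂_eq]⟩

theorem map_of_eq_one_and_pow_eq_one {G : Type*} [Group G] {p : ℕ} {k : ℤ}
    {f : FreeGroup Gen8 →* G} (hf : ∀ r ∈ rels8 p k, f r = 1) :
    f X = 1 ∧ f Y = 1 ∧ f A1 = 1 ∧ f B1 = 1 ∧ f B2 = 1 ∧ f A2 ^ p = 1 := by
  simp only [rels8, Set.mem_insert_iff, Set.mem_singleton_iff, forall_eq_or_imp, forall_eq,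
    fgComm, map_mul, map_inv, map_pow, map_zpow,
    ← commutatorElement_def, map_commutatorElement] at hf
  obtain ⟨-, ya₁, -, ya₂, -, -, -, -, -, hb₁, ha₁, hb₂, hx, ha₂, hy⟩ := hf
  rw [commutatorElement_eq_one_iff_commute] at ya₁ ya₂
  rw [mul_inv_eq_one] at hb₁ ha₁ hb₂ hx ha₂ hy
  exact trivial_of_relations ya₁ ya₂ hb₁ ha₁ hb₂ hx ha₂ hy

theorem of_eq_one_and_pow_eq_one (p : ℕ) (k : ℤ) :
    let q : Gen8 → PresentedGroup (rels8 p k) := PresentedGroup.of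
    q x = 1 ∧ q y = 1 ∧ q a1 = 1 ∧ q b1 = 1 ∧ q b2 = 1 ∧ q a2 ^ p = 1 :=
  map_of_eq_one_and_pow_eq_one fun _ => PresentedGroup.one_of_mem

theorem zpowers_of_a2 (p : ℕ) (k : ℤ) :
    Subgroup.zpowers (PresentedGroup.of a2 : PresentedGroup (rels8 p k)) = ⊤ := by
  obtain ⟨hx, hy, ha₁, hb₁, hb₂, -⟩ := of_eq_one_and_pow_eq_one p k
  refine PresentedGroup.eq_top_of_forall_of_mem fun g => ?_
  cases g <;> simp [hx, hy, ha₁, hb₁, hb₂, one_mem]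

/-- The homomorphism to `ℤ/pℤ` sending `a₂` to `1` and the other generators to `0`. -/
def toZMod (p : ℕ) (k : ℤ) : PresentedGroup (rels8 p k) →* Multiplicative (ZMod p) :=
  PresentedGroup.toGroup (f := Pi.mulSingle a2 (Multiplicative.ofAdd 1)) <| by
    simp [rels8, fgComm, X, Y, A1, B1, A2, B2, ← ofAdd_nsmul]

theorem toZMod_of_a2 (p : ℕ) (k : ℤ) :
    toZMod p k (PresentedGroup.of a2) = Multiplicative.ofAdd 1 := by
  simp [toZMod]

theorem toZMod_bijective (p : ℕ) (k : ℤ) : Function.Bijective (toZMod p k) := by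
  constructor
  · rw [injective_iff_map_eq_one]
    intro g hg
    obtain ⟨n, rfl⟩ := Subgroup.mem_zpowers_iff.mp
      ((zpowers_of_a2 p k).symm ▸ Subgroup.mem_top g)
    rw [map_zpow, toZMod_of_a2, ← ofAdd_zsmul, ofAdd_eq_one, zsmul_one,
      ZMod.intCast_zmod_eq_zero_iff_dvd] at hg
    obtain ⟨m, rfl⟩ := hg
    obtain ⟨-, -, -, -, -, h⟩ := of_eq_one_and_pow_eq_one p k
    rw [zpow_mul, zpow_natCast, h, one_zpow]
  · intro z
    obtain ⟨n, hn⟩ := ZMod.intCast_surjective z.toAdd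
    refine ⟨PresentedGroup.of a2 ^ n, ?_⟩
    rw [map_zpow, toZMod_of_a2, ← ofAdd_zsmul, zsmul_one, hn, ofAdd_toAdd]

end Gen8

/-- The presented group
`⟨x, y, a₁, b₁, a₂, b₂ | [x,a₁] = [y,a₁] = [x,a₂] = [y,a₂] = 1,
[b₁,b₂] = [a₁,b₂] = [b₁,a₁] = [b₂,a₂] = 1, [x,y] = 1, b₁ = [a₂⁻¹,a₁⁻¹],
a₁ = [b₁⁻¹,y⁻¹], b₂ = [b₁,a₂], x⁻¹ = [b₂⁻¹,y⁻¹], a₂ᵖ = [x⁻¹,b₂], y = [x⁻¹,b₁]ᵏ⟩`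
is isomorphic to `ℤ/pℤ`, generated by the image of `a₂`. -/
theorem stmt_8 (p : ℕ) (hp : 1 ≤ p) (k : ℤ) :
    Nonempty (PresentedGroup (Gen8.rels8 p k) ≃* Multiplicative (ZMod p)) ∧
    Subgroup.zpowers (PresentedGroup.of Gen8.a2 : PresentedGroup (Gen8.rels8 p k)) = ⊤ := by
  exact ⟨⟨MulEquiv.ofBijective (Gen8.toZMod p k) (Gen8.toZMod_bijective p k)⟩,
    Gen8.zpowers_of_a2 p k⟩
end

section
/- Let k be an integer. The group with presentation ⟨x, y, a₁, b₁, a₂, b₂ | [x,a₁] = [y,a₁] = [x,a₂] = [y,a₂] = 1, [b₁,b₂] = [a₁,b₂] = [b₁,a₁] = [b₂,a₂] = 1, [x,y] = 1, b₁ = [a₂⁻¹,a₁⁻¹], a₁ = [b₁⁻¹,y⁻¹], b₂ = [b₁,a₂], x⁻¹ = [b₂⁻¹,y⁻¹], y = [x⁻¹,b₁]ᵏ⟩ is infinite cyclic, generated by the image of a₂. -/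
/-- Generators of the presentation: `x, y, a₁, b₁, a₂, b₂`. -/
inductive Gen9 : Type
  | x | y | a1 | b1 | a2 | b2
  deriving DecidableEq

namespace Gen9

/-- The commutator `[u, v] = u v u⁻¹ v⁻¹` in the free group. -/
def fgComm (u v : FreeGroup Gen9) : FreeGroup Gen9 := u * v * u⁻¹ * v⁻¹

def X : FreeGroup Gen9 := FreeGroup.of Gen9.x
def Y : FreeGroup Gen9 := FreeGroup.of Gen9.y
def A1 : FreeGroup Gen9 := FreeGroup.of Gen9.a1
def B1 : FreeGroup Gen9 := FreeGroup.of Gen9.b1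
def A2 : FreeGroup Gen9 := FreeGroup.of Gen9.a2
def B2 : FreeGroup Gen9 := FreeGroup.of Gen9.b2

/-- Relators: the commutation relations together with the relations introduced by the
torus surgeries (a relation `u = v` becomes the relator `u * v⁻¹`); the relation
`a₂ᵖ = [x⁻¹,b₂]` of the finite cyclic case is omitted. -/
def rels9 (k : ℤ) : Set (FreeGroup Gen9) :=
  { fgComm X A1, fgComm Y A1, fgComm X A2, fgComm Y A2,
    fgComm B1 B2, fgComm A1 B2, fgComm B1 A1, fgComm B2 A2,
    fgComm X Y,
    B1 * (fgComm A2⁻¹ A1⁻¹)⁻¹,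
    A1 * (fgComm B1⁻¹ Y⁻¹)⁻¹,
    B2 * (fgComm B1 A2)⁻¹,
    X⁻¹ * (fgComm B2⁻¹ Y⁻¹)⁻¹,
    Y * ((fgComm X⁻¹ B1) ^ k)⁻¹ }

end Gen9

namespace Gen9

open scoped commutatorElement

/-- The relations for `x, y, a₁, b₁, a₂, b₂` force every generator but `a₂` to be trivial: `y`
commutes with `a₁` and `a₂`, hence with `b₁ = [a₂⁻¹, a₁⁻¹]`, so `a₁ = [b₁⁻¹, y⁻¹] = 1`. -/
theorem eq_one_of_relations {G : Type*} [Group G] {x y a₁ b₁ a₂ b₂ : G} {k : ℤ}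
    (hya₁ : Commute y a₁) (hya₂ : Commute y a₂)
    (hb₁ : b₁ = ⁅a₂⁻¹, a₁⁻¹⁆) (ha₁ : a₁ = ⁅b₁⁻¹, y⁻¹⁆) (hb₂ : b₂ = ⁅b₁, a₂⁆)
    (hx : x⁻¹ = ⁅b₂⁻¹, y⁻¹⁆) (hy : y = ⁅x⁻¹, b₁⁆ ^ k) :
    x = 1 ∧ y = 1 ∧ a₁ = 1 ∧ b₁ = 1 ∧ b₂ = 1 := by
  have hyb₁ : Commute y b₁ := by
    rw [hb₁, commutatorElement_def]
    exact ((hya₂.inv_right.mul_right hya₁.inv_right).mul_right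
      hya₂.inv_right.inv_right).mul_right hya₁.inv_right.inv_right
  have ha₁' : a₁ = 1 := by
    rw [ha₁, commutatorElement_eq_one_iff_commute]
    exact hyb₁.symm.inv_inv
  have hb₁' : b₁ = 1 := by simpa [ha₁'] using hb₁
  have hb₂' : b₂ = 1 := by simpa [hb₁'] using hb₂
  have hx' : x = 1 := by simpa [hb₂'] using hx
  have hy' : y = 1 := by simpa [hb₁'] using hy
  exact ⟨hx', hy', ha₁', hb₁', hb₂'⟩

theorem of_eq_one (k : ℤ) (g : Gen9) (hg : g ≠ a2) :
    (PresentedGroup.of g : PresentedGroup (rels9 k)) = 1 := by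
  have rel : ∀ {r}, r ∈ rels9 k → PresentedGroup.mk (rels9 k) r = 1 :=
    fun h => PresentedGroup.one_of_mem h
  have mk_of (g : Gen9) : PresentedGroup.mk (rels9 k) (FreeGroup.of g) = .of g := rfl
  have hya₁ := rel (r := fgComm Y A1) (by simp [rels9])
  have hya₂ := rel (r := fgComm Y A2) (by simp [rels9])
  have hb₁ := rel (r := B1 * (fgComm A2⁻¹ A1⁻¹)⁻¹) (by simp [rels9])
  have ha₁ := rel (r := A1 * (fgComm B1⁻¹ Y⁻¹)⁻¹) (by simp [rels9])
  have hb₂ := rel (r := B2 * (fgComm B1 A2)⁻¹) (by simp [rels9])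
  have hx := rel (r := X⁻¹ * (fgComm B2⁻¹ Y⁻¹)⁻¹) (by simp [rels9])
  have hy := rel (r := Y * ((fgComm X⁻¹ B1) ^ k)⁻¹) (by simp [rels9])
  simp only [fgComm, X, Y, A1, A2, B1, B2, ← commutatorElement_def, map_mul, map_inv, map_zpow,
    map_commutatorElement, mk_of, commutatorElement_eq_one_iff_commute, mul_inv_eq_one]
    at hya₁ hya₂ hb₁ ha₁ hb₂ hx hy
  obtain ⟨hx', hy', ha₁', hb₁', hb₂'⟩ := eq_one_of_relations hya₁ hya₂ hb₁ ha₁ hb₂ hx hy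
  cases g <;> first | assumption | exact absurd rfl hg

theorem zpowers_of_a2 (k : ℤ) :
    Subgroup.zpowers (PresentedGroup.of a2 : PresentedGroup (rels9 k)) = ⊤ := by
  rw [eq_top_iff, ← PresentedGroup.closure_range_of (rels9 k), Subgroup.closure_le]
  rintro _ ⟨g, rfl⟩
  by_cases hg : g = a2
  · exact hg ▸ Subgroup.mem_zpowers _
  · rw [of_eq_one k g hg]
    exact one_mem _

/-- The exponent-sum homomorphism in `a₂`. -/
def exponentSum (k : ℤ) : PresentedGroup (rels9 k) →* Multiplicative ℤ :=
  PresentedGroup.toGroup (f := fun g => if g = a2 then Multiplicative.ofAdd 1 else 1) (by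
    intro r hr
    simp only [rels9, Set.mem_insert_iff, Set.mem_singleton_iff] at hr
    rcases hr with rfl | rfl | rfl | rfl | rfl | rfl | rfl | rfl | rfl | rfl | rfl | rfl | rfl | rfl
      <;> simp [fgComm, X, Y, A1, A2, B1, B2])

theorem exponentSum_of_a2 (k : ℤ) :
    exponentSum k (PresentedGroup.of a2) = Multiplicative.ofAdd 1 := by
  simp [exponentSum]

end Gen9

/-- The presented group
`⟨x, y, a₁, b₁, a₂, b₂ | [x,a₁] = [y,a₁] = [x,a₂] = [y,a₂] = 1,
[b₁,b₂] = [a₁,b₂] = [b₁,a₁] = [b₂,a₂] = 1, [x,y] = 1, b₁ = [a₂⁻¹,a₁⁻¹],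
a₁ = [b₁⁻¹,y⁻¹], b₂ = [b₁,a₂], x⁻¹ = [b₂⁻¹,y⁻¹], y = [x⁻¹,b₁]ᵏ⟩`
is infinite cyclic, generated by the image of `a₂`. -/
theorem stmt_9 (k : ℤ) :
    Nonempty (PresentedGroup (Gen9.rels9 k) ≃* Multiplicative ℤ) ∧
    Subgroup.zpowers (PresentedGroup.of Gen9.a2 : PresentedGroup (Gen9.rels9 k)) = ⊤ := by
  have hgen := Gen9.zpowers_of_a2 k
  refine ⟨⟨MulEquiv.ofBijective (Gen9.exponentSum k) ⟨?_, fun n => ?_⟩⟩, hgen⟩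
  · rw [injective_iff_map_eq_one]
    intro g hg
    obtain ⟨n, rfl⟩ := Subgroup.mem_zpowers_iff.mp (hgen ▸ Subgroup.mem_top g)
    rw [map_zpow, Gen9.exponentSum_of_a2, ← ofAdd_zsmul, ofAdd_eq_one] at hg
    have hn : n = 0 := by simpa using hg
    rw [hn, zpow_zero]
  · refine ⟨PresentedGroup.of Gen9.a2 ^ n.toAdd, ?_⟩
    rw [map_zpow, Gen9.exponentSum_of_a2, ← ofAdd_zsmul]
    simp
end

section
/- The group with presentation ⟨α₁, α₂, α₃, α₄, c, d | α₃ = [α₁⁻¹, α₄⁻¹], [α₁,α₂] = [α₁,α₃] = [α₂,α₃] = [α₂,α₄] = 1, [c,d] = 1, c = α₁, d = α₂, α₃² = c⁻¹, α₄ = d⁻¹⟩ is infinite cyclic, generated by the image of d. -/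
/-- Generators of the presentation: `α₁, α₂, α₃, α₄, c, d`. -/
inductive Gen10 : Type
  | α1 | α2 | α3 | α4 | c | d
  deriving DecidableEq

namespace Gen10

/-- The commutator `[u, v] = u v u⁻¹ v⁻¹` in the free group. -/
def fgComm (u v : FreeGroup Gen10) : FreeGroup Gen10 := u * v * u⁻¹ * v⁻¹

def A1 : FreeGroup Gen10 := FreeGroup.of Gen10.α1
def A2 : FreeGroup Gen10 := FreeGroup.of Gen10.α2
def A3 : FreeGroup Gen10 := FreeGroup.of Gen10.α3
def A4 : FreeGroup Gen10 := FreeGroup.of Gen10.α4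
def C : FreeGroup Gen10 := FreeGroup.of Gen10.c
def D : FreeGroup Gen10 := FreeGroup.of Gen10.d

/-- Relators (a relation `u = v` becomes the relator `u * v⁻¹`). -/
def rels10 : Set (FreeGroup Gen10) :=
  { A3 * (fgComm A1⁻¹ A4⁻¹)⁻¹,
    fgComm A1 A2, fgComm A1 A3, fgComm A2 A3, fgComm A2 A4,
    fgComm C D,
    C * A1⁻¹,
    D * A2⁻¹,
    A3 ^ 2 * (C⁻¹)⁻¹,
    A4 * (D⁻¹)⁻¹ }

end Gen10

namespace Gen10

/-- The image of each generator in the infinite cyclic group, with `d` sent to the generator. -/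
def toIntGen : Gen10 → Multiplicative ℤ
  | α1 | α3 | c => 1
  | α2 | d => Multiplicative.ofAdd 1
  | α4 => Multiplicative.ofAdd (-1)

/-- The homomorphism from the presented group to the infinite cyclic group sending `d` to the
generator. -/
def toInt : PresentedGroup rels10 →* Multiplicative ℤ :=
  PresentedGroup.toGroup (f := toIntGen) <| by
    simp only [rels10, Set.mem_insert_iff, Set.mem_singleton_iff]
    rintro r (rfl | rfl | rfl | rfl | rfl | rfl | rfl | rfl | rfl | rfl) <;>
      simp [fgComm, A1, A2, A3, A4, C, D, toIntGen]

/-- Since `α₄ = α₂⁻¹` commutes with `α₁`, the element `α₃ = [α₁⁻¹, α₄⁻¹]` is trivial, hence so is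
`α₁ = α₃⁻²`. -/
theorem eq_of_relations {G : Type*} [Group G] {a₁ a₂ a₃ a₄ x y : G}
    (h₃ : a₃ = a₁⁻¹ * a₄⁻¹ * a₁ * a₄) (hcomm : Commute a₁ a₂) (hx : x = a₁) (hy : y = a₂)
    (hsq : a₃ ^ 2 = x⁻¹) (h₄ : a₄ = y⁻¹) :
    a₁ = 1 ∧ a₂ = y ∧ a₃ = 1 ∧ a₄ = y⁻¹ ∧ x = 1 := by
  subst hx hy h₄
  have h : a₃ = 1 := by
    rw [h₃, inv_inv, mul_assoc x⁻¹, ← hcomm.eq]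
    group
  have hx : x = 1 := by simpa [h, eq_comm] using hsq
  exact ⟨hx, rfl, h, rfl, hx⟩

theorem of_eq_zpow (i : Gen10) :
    (PresentedGroup.of i : PresentedGroup rels10) =
      PresentedGroup.of d ^ (toIntGen i).toAdd := by
  have hrel {r : FreeGroup Gen10} (hr : r ∈ rels10) : PresentedGroup.mk rels10 r = 1 :=
    PresentedGroup.one_of_mem hr
  have h₃ := hrel (r := A3 * (fgComm A1⁻¹ A4⁻¹)⁻¹) (by simp [rels10])
  have hcomm := hrel (r := fgComm A1 A2) (by simp [rels10])
  have hc := hrel (r := C * A1⁻¹) (by simp [rels10])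
  have hd := hrel (r := D * A2⁻¹) (by simp [rels10])
  have hsq := hrel (r := A3 ^ 2 * (C⁻¹)⁻¹) (by simp [rels10])
  have h₄ := hrel (r := A4 * (D⁻¹)⁻¹) (by simp [rels10])
  simp only [fgComm, map_mul, map_inv, map_pow, mul_inv_eq_one, inv_inv] at h₃ hcomm hc hd hsq h₄
  let φ : Gen10 → PresentedGroup rels10 := PresentedGroup.of
  obtain ⟨e₁, e₂, e₃, e₄, ec⟩ :
      φ α1 = 1 ∧ φ α2 = φ d ∧ φ α3 = 1 ∧ φ α4 = (φ d)⁻¹ ∧ φ c = 1 :=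
    eq_of_relations h₃ (mul_inv_eq_iff_eq_mul.mp hcomm) hc hd
      (eq_inv_of_mul_eq_one_left hsq) (eq_inv_of_mul_eq_one_left h₄)
  cases i
  · simpa [toIntGen] using e₁
  · simpa [toIntGen] using e₂
  · simpa [toIntGen] using e₃
  · simpa [toIntGen] using e₄
  · simpa [toIntGen] using ec
  · simp [toIntGen]

theorem zpow_toInt (g : PresentedGroup rels10) :
    (PresentedGroup.of d : PresentedGroup rels10) ^ (toInt g).toAdd = g := by
  have h : (zpowersHom _ (PresentedGroup.of d)).comp toInt =
      MonoidHom.id (PresentedGroup rels10) :=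
    PresentedGroup.ext fun i => by
      simp [toInt, ← of_eq_zpow]
  exact DFunLike.congr_fun h g

end Gen10

/-- The presented group
`⟨α₁, α₂, α₃, α₄, c, d | α₃ = [α₁⁻¹, α₄⁻¹], [α₁,α₂] = [α₁,α₃] = [α₂,α₃] = [α₂,α₄] = 1,
[c,d] = 1, c = α₁, d = α₂, α₃² = c⁻¹, α₄ = d⁻¹⟩`
is infinite cyclic, generated by the image of `d`. -/
theorem stmt_10 :
    Nonempty (PresentedGroup Gen10.rels10 ≃* Multiplicative ℤ) ∧
    Subgroup.zpowers (PresentedGroup.of Gen10.d : PresentedGroup Gen10.rels10) = ⊤ := by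
  refine ⟨⟨Gen10.toInt.toMulEquiv (zpowersHom _ (PresentedGroup.of Gen10.d))
    (MonoidHom.ext Gen10.zpow_toInt) ?_⟩, ?_⟩
  · ext
    simp [Gen10.toInt, Gen10.toIntGen]
  · exact (Subgroup.eq_top_iff' _).mpr fun g => ⟨_, Gen10.zpow_toInt g⟩
end

section
/- Let p ≥ 1 be an integer. The group with presentation ⟨α₁, α₂, α₃, α₄, c, d | α₃ = [α₁⁻¹, α₄⁻¹], [α₁,α₂] = [α₂,α₃] = [α₂,α₄] = 1, α₄ᵖ = [α₁, α₃⁻¹], [c,d] = 1, c = α₁, d = α₂, α₃² = c⁻¹, α₄ = d⁻¹⟩ is isomorphic to the cyclic group ℤ/pℤ. -/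
/-- Generators of the presentation: `α₁, α₂, α₃, α₄, c, d`. -/
inductive Gen11 : Type
  | α1 | α2 | α3 | α4 | c | d
  deriving DecidableEq

namespace Gen11

/-- The commutator `[u, v] = u v u⁻¹ v⁻¹` in the free group. -/
def fgComm (u v : FreeGroup Gen11) : FreeGroup Gen11 := u * v * u⁻¹ * v⁻¹

def A1 : FreeGroup Gen11 := FreeGroup.of Gen11.α1
def A2 : FreeGroup Gen11 := FreeGroup.of Gen11.α2
def A3 : FreeGroup Gen11 := FreeGroup.of Gen11.α3
def A4 : FreeGroup Gen11 := FreeGroup.of Gen11.α4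
def C : FreeGroup Gen11 := FreeGroup.of Gen11.c
def D : FreeGroup Gen11 := FreeGroup.of Gen11.d

/-- Relators (a relation `u = v` becomes the relator `u * v⁻¹`); the relation
`[α₁,α₃] = 1` is replaced by `α₄ᵖ = [α₁, α₃⁻¹]` via the extra Luttinger surgery. -/
def rels11 (p : ℕ) : Set (FreeGroup Gen11) :=
  { A3 * (fgComm A1⁻¹ A4⁻¹)⁻¹,
    fgComm A1 A2, fgComm A2 A3, fgComm A2 A4,
    A4 ^ p * (fgComm A1 A3⁻¹)⁻¹,
    fgComm C D,
    C * A1⁻¹,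
    D * A2⁻¹,
    A3 ^ 2 * (C⁻¹)⁻¹,
    A4 * (D⁻¹)⁻¹ }

end Gen11

/-- The homomorphism from the cyclic group of order `p` sending the generator to an element `x`
with `x ^ p = 1`. -/
def zmodPowHom {G : Type*} [Group G] (p : ℕ) (x : G) (hx : x ^ p = 1) :
    Multiplicative (ZMod p) →* G :=
  AddMonoidHom.toMultiplicativeLeft
    (ZMod.lift p ⟨zmultiplesHom (Additive G) (Additive.ofMul x), by
      simp [← ofMul_pow, hx]⟩)

theorem zmodPowHom_ofAdd_one {G : Type*} [Group G] (p : ℕ) (x : G) (hx : x ^ p = 1) :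
    zmodPowHom p x hx (Multiplicative.ofAdd 1) = x := by
  have h := ZMod.lift_coe p (A := Additive G)
    ⟨zmultiplesHom (Additive G) (Additive.ofMul x), by simp [← ofMul_pow, hx]⟩ 1
  simp only [Int.cast_one, zmultiplesHom_apply, one_zsmul] at h
  exact congrArg Additive.toMul h

namespace Gen11

/-- Images of the generators in the cyclic group of order `p`. -/
def toCyclic (p : ℕ) : Gen11 → Multiplicative (ZMod p)
  | α1 | α3 | c => 1
  | α2 | d => (Multiplicative.ofAdd 1)⁻¹
  | α4 => Multiplicative.ofAdd 1

theorem lift_toCyclic_eq_one (p : ℕ) :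
    ∀ r ∈ rels11 p, FreeGroup.lift (toCyclic p) r = 1 := by
  have h : (Multiplicative.ofAdd (1 : ZMod p)) ^ p = 1 := by
    rw [← ofAdd_nsmul]
    simp
  simp [rels11, fgComm, A1, A2, A3, A4, C, D, toCyclic, h]

/-- In a group satisfying the relations, `α₁`, `α₃` and `c` are trivial, `α₂` and `d` are inverse
to `α₄`, and `α₄ ^ p = 1`. -/
theorem values_of_lift_eq_one {G : Type*} [Group G] (p : ℕ) (f : FreeGroup Gen11 →* G)
    (h : ∀ r ∈ rels11 p, f r = 1) :
    f A1 = 1 ∧ f A3 = 1 ∧ f C = 1 ∧ f A2 = (f A4)⁻¹ ∧ f D = (f A4)⁻¹ ∧ f A4 ^ p = 1 := by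
  simp only [rels11, Set.mem_insert_iff, Set.mem_singleton_iff, forall_eq_or_imp, forall_eq,
    fgComm, map_mul, map_inv, map_pow, inv_inv, mul_inv_eq_one] at h
  obtain ⟨h3, h12, -, -, hp, -, hc, hd, hc3, h4⟩ := h
  have h24 : f A2 = (f A4)⁻¹ := by
    rw [← hd]
    exact eq_inv_of_mul_eq_one_right h4
  have hcomm : Commute (f A1) (f A4) := by
    have h' : Commute (f A1) (f A2) := mul_inv_eq_iff_eq_mul.mp h12
    rw [h24] at h'
    exact Commute.inv_right_iff.mp h'
  have h3' : f A3 = 1 := by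
    rw [h3, hcomm.inv_inv.eq]
    group
  have hc' : f C = 1 := by simpa [h3'] using hc3
  have h1 : f A1 = 1 := hc ▸ hc'
  exact ⟨h1, h3', hc', h24, hd.trans h24, by simpa [h1, h3'] using hp⟩

end Gen11

/-- The presented group
`⟨α₁, α₂, α₃, α₄, c, d | α₃ = [α₁⁻¹, α₄⁻¹], [α₁,α₂] = [α₂,α₃] = [α₂,α₄] = 1,
α₄ᵖ = [α₁, α₃⁻¹], [c,d] = 1, c = α₁, d = α₂, α₃² = c⁻¹, α₄ = d⁻¹⟩`
is isomorphic to the cyclic group `ℤ/pℤ`. -/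
theorem stmt_11 (p : ℕ) (hp : 1 ≤ p) :
    Nonempty (PresentedGroup (Gen11.rels11 p) ≃* Multiplicative (ZMod p)) := by
  let π := PresentedGroup.mk (Gen11.rels11 p)
  obtain ⟨h1, h3, hc, h2, hd, h4⟩ := Gen11.values_of_lift_eq_one p π
    fun _ hr => PresentedGroup.one_of_mem hr
  let f := PresentedGroup.toGroup (Gen11.lift_toCyclic_eq_one p)
  let g := zmodPowHom p (π Gen11.A4) h4
  have hf (x : Gen11) : f (PresentedGroup.of x) = Gen11.toCyclic p x :=
    PresentedGroup.toGroup.of _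
  have hg : g (Multiplicative.ofAdd 1) = π Gen11.A4 := zmodPowHom_ofAdd_one p _ h4
  refine ⟨MonoidHom.toMulEquiv f g ?_ ?_⟩
  · refine PresentedGroup.ext fun x => ?_
    rw [MonoidHom.comp_apply, hf]
    cases x
    · exact (map_one g).trans h1.symm
    · exact (map_inv g _).trans ((congrArg _ hg).trans h2.symm)
    · exact (map_one g).trans h3.symm
    · exact hg
    · exact (map_one g).trans hc.symm
    · exact (map_inv g _).trans ((congrArg _ hg).trans hd.symm)
  · have hfg : f (g (Multiplicative.ofAdd 1)) = Multiplicative.ofAdd 1 := by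
      rw [hg]
      exact hf Gen11.α4
    refine MonoidHom.ext fun x => ?_
    obtain ⟨n, hn⟩ := ZMod.intCast_surjective x.toAdd
    have hx : x = Multiplicative.ofAdd (1 : ZMod p) ^ n := by
      rw [← ofAdd_zsmul, zsmul_one, hn, ofAdd_toAdd]
    rw [hx, map_zpow, map_zpow, MonoidHom.comp_apply, hfg, MonoidHom.id_apply]
end

section
/- The group with presentation ⟨a₁, b₁, a₂, b₂, c, d, α₃ | a₁ = [b₁⁻¹, d⁻¹], b₁ = [a₁⁻¹, d], d = [c⁻¹, b₂], [a₁,c] = [b₁,c] = [a₂,c] = [a₂,d] = 1, [a₁,b₁][a₂,b₂] = 1, α₃ = [a₁⁻¹, b₂⁻¹], b₂ = [a₁, α₃⁻¹], [b₁,α₃] = [b₁,b₂] = 1, a₂ = α₃²⟩ is infinite cyclic, generated by the image of c. -/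
/-- Generators of the presentation: `a₁, b₁, a₂, b₂, c, d, α₃`. -/
inductive Gen12 : Type
  | a1 | b1 | a2 | b2 | c | d | α3
  deriving DecidableEq

namespace Gen12

/-- The commutator `[u, v] = u v u⁻¹ v⁻¹` in the free group. -/
def fgComm (u v : FreeGroup Gen12) : FreeGroup Gen12 := u * v * u⁻¹ * v⁻¹

def A1 : FreeGroup Gen12 := FreeGroup.of Gen12.a1
def B1 : FreeGroup Gen12 := FreeGroup.of Gen12.b1
def A2 : FreeGroup Gen12 := FreeGroup.of Gen12.a2
def B2 : FreeGroup Gen12 := FreeGroup.of Gen12.b2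
def C : FreeGroup Gen12 := FreeGroup.of Gen12.c
def D : FreeGroup Gen12 := FreeGroup.of Gen12.d
def A3 : FreeGroup Gen12 := FreeGroup.of Gen12.α3

/-- Relators (a relation `u = v` becomes the relator `u * v⁻¹`). -/
def rels12 : Set (FreeGroup Gen12) :=
  { A1 * (fgComm B1⁻¹ D⁻¹)⁻¹,
    B1 * (fgComm A1⁻¹ D)⁻¹,
    D * (fgComm C⁻¹ B2)⁻¹,
    fgComm A1 C, fgComm B1 C, fgComm A2 C, fgComm A2 D,
    fgComm A1 B1 * fgComm A2 B2,
    A3 * (fgComm A1⁻¹ B2⁻¹)⁻¹,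
    B2 * (fgComm A1 A3⁻¹)⁻¹,
    fgComm B1 A3, fgComm B1 B2,
    A2 * (A3 ^ 2)⁻¹ }

end Gen12

namespace Gen12

/-- In any group, elements satisfying the relations that involve `b₁`, `d`, `b₂`, `c`, `α₃`
force every generator other than `c` to be trivial. -/
theorem eq_one_of_relations {G : Type*} [Group G] {a b e c d x : G}
    (ha : a = b⁻¹ * d⁻¹ * b⁻¹⁻¹ * d⁻¹⁻¹) (hb : b = a⁻¹ * d * a⁻¹⁻¹ * d⁻¹)
    (hd : d = c⁻¹ * e * c⁻¹⁻¹ * e⁻¹) (hx : x = a⁻¹ * e⁻¹ * a⁻¹⁻¹ * e⁻¹⁻¹)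
    (he : e = a * x⁻¹ * a⁻¹ * x⁻¹⁻¹) (hbc : Commute b c) (hbe : Commute b e) :
    a = 1 ∧ b = 1 ∧ e = 1 ∧ d = 1 ∧ x = 1 := by
  have hbd : Commute b d := by
    rw [hd]
    exact ((hbc.inv_right.mul_right hbe).mul_right hbc.inv_right.inv_right).mul_right
      hbe.inv_right
  have ha1 : a = 1 := by
    rw [ha, hbd.inv_inv.eq]
    group
  subst ha1
  have hx1 : x = 1 := by simpa using hx
  have he1 : e = 1 := by simpa [hx1] using he
  have hb1 : b = 1 := by simpa using hb
  have hd1 : d = 1 := by simpa [he1] using hd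
  exact ⟨rfl, hb1, he1, hd1, hx1⟩

theorem of_eq_one_of_ne_c {g : Gen12} (hg : g ≠ c) :
    (PresentedGroup.of g : PresentedGroup rels12) = 1 := by
  have key (u v : FreeGroup Gen12) (h : u * v⁻¹ ∈ rels12) :
      PresentedGroup.mk rels12 u = PresentedGroup.mk rels12 v := by
    simpa [mul_inv_eq_one] using PresentedGroup.one_of_mem h
  have comm (u v : FreeGroup Gen12) (h : fgComm u v ∈ rels12) :
      Commute (PresentedGroup.mk rels12 u) (PresentedGroup.mk rels12 v) := by
    have := PresentedGroup.one_of_mem h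
    simp only [fgComm, map_mul, map_inv] at this
    rwa [← commutatorElement_def, commutatorElement_eq_one_iff_commute] at this
  obtain ⟨ha, hb, he, hd, hx⟩ := eq_one_of_relations
    (by simpa only [fgComm, map_mul, map_inv] using
      key A1 (fgComm B1⁻¹ D⁻¹) (by simp [rels12]))
    (by simpa only [fgComm, map_mul, map_inv] using
      key B1 (fgComm A1⁻¹ D) (by simp [rels12]))
    (by simpa only [fgComm, map_mul, map_inv] using
      key D (fgComm C⁻¹ B2) (by simp [rels12]))
    (by simpa only [fgComm, map_mul, map_inv] using
      key A3 (fgComm A1⁻¹ B2⁻¹) (by simp [rels12]))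
    (by simpa only [fgComm, map_mul, map_inv] using
      key B2 (fgComm A1 A3⁻¹) (by simp [rels12]))
    (comm B1 C (by simp [rels12])) (comm B1 B2 (by simp [rels12]))
  have hz := key A2 (A3 ^ 2) (by simp [rels12])
  rw [map_pow, hx, one_pow] at hz
  cases g
  exacts [ha, hb, hz, he, absurd rfl hg, hd, hx]

theorem zpowers_of_c_eq_top :
    Subgroup.zpowers (PresentedGroup.of c : PresentedGroup rels12) = ⊤ := by
  rw [eq_top_iff, ← PresentedGroup.closure_range_of rels12, Subgroup.closure_le]
  rintro _ ⟨g, rfl⟩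
  by_cases hg : g = c
  · exact hg ▸ Subgroup.mem_zpowers _
  · rw [of_eq_one_of_ne_c hg]
    exact one_mem _

/-- The homomorphism to `ℤ` counting the exponent sum of `c`. -/
def exponentSum : PresentedGroup rels12 →* Multiplicative ℤ :=
  PresentedGroup.toGroup (f := fun g => if g = c then Multiplicative.ofAdd 1 else 1) (by
    intro r hr
    simp only [rels12, Set.mem_insert_iff, Set.mem_singleton_iff] at hr
    rcases hr with h | h | h | h | h | h | h | h | h | h | h | h | h <;>
      simp [h, fgComm, A1, B1, A2, B2, C, D, A3])

theorem exponentSum_of_c : exponentSum (PresentedGroup.of c) = Multiplicative.ofAdd 1 := by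
  simp [exponentSum]

theorem exponentSum_bijective : Function.Bijective exponentSum := by
  constructor
  · rw [injective_iff_map_eq_one]
    intro y hy
    obtain ⟨n, rfl⟩ := Subgroup.mem_zpowers_iff.1 (zpowers_of_c_eq_top ▸ Subgroup.mem_top y)
    rw [map_zpow, exponentSum_of_c, ← ofAdd_zsmul, ofAdd_eq_one] at hy
    simp_all
  · intro n
    refine ⟨PresentedGroup.of c ^ n.toAdd, ?_⟩
    rw [map_zpow, exponentSum_of_c, ← ofAdd_zsmul]
    simp

end Gen12

/-- The presented group
`⟨a₁, b₁, a₂, b₂, c, d, α₃ | a₁ = [b₁⁻¹, d⁻¹], b₁ = [a₁⁻¹, d], d = [c⁻¹, b₂],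
[a₁,c] = [b₁,c] = [a₂,c] = [a₂,d] = 1, [a₁,b₁][a₂,b₂] = 1, α₃ = [a₁⁻¹, b₂⁻¹],
b₂ = [a₁, α₃⁻¹], [b₁,α₃] = [b₁,b₂] = 1, a₂ = α₃²⟩`
is infinite cyclic, generated by the image of `c`. -/
theorem stmt_12 :
    Nonempty (PresentedGroup Gen12.rels12 ≃* Multiplicative ℤ) ∧
    Subgroup.zpowers (PresentedGroup.of Gen12.c : PresentedGroup Gen12.rels12) = ⊤ := by
  exact ⟨⟨MulEquiv.ofBijective Gen12.exponentSum Gen12.exponentSum_bijective⟩,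
    Gen12.zpowers_of_c_eq_top⟩
end
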